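/- For every integer d ≥ 3 there exists a 2-connected simple graph G with girth at least d such that spc(G) ≥ 4, i.e., no edge coloring of G with 3 colors is strongly proper connected. -/

import Mathlib

open SimpleGraph

/-- A list of colors is *strongly proper* if any two of its terms at distance
at most 2 are distinct. -/
def StronglyProperSeq {α : Type*} (l : List α) : Prop :=
  ∀ i j : ℕ, i < j → j ≤ i + 2 → ∀ (hi : i < l.length) (hj : j < l.length),
    l.get ⟨i, hi⟩ ≠ l.get ⟨j, hj⟩

/-- An edge coloring of `G` is strongly proper connected if every pair of distinct
vertices is joined by a path whose sequence of edge colors is strongly proper. -/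
def IsStronglyProperConnected {V : Type*} (G : SimpleGraph V) {β : Type*}
    (c : Sym2 V → β) : Prop :=
  ∀ u v : V, u ≠ v → ∃ p : G.Walk u v, p.IsPath ∧ StronglyProperSeq (p.edges.map c)

/-- `G` is `k`-connected: it has more than `k` vertices and deleting any set of
fewer than `k` vertices leaves a connected graph. -/
def KConnected {V : Type*} (k : ℕ) (G : SimpleGraph V) : Prop :=
  k < Nat.card V ∧
    ∀ S : Set V, S.Finite → S.ncard < k → (G.induce Sᶜ).Connected

/-- The vertices of the theta graph made of `n + 1` internally disjoint paths of length `L`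
between two hubs: pairs consisting of a path and a position on it, where the two hubs
(positions `0` and `L`) are assigned to path `0`. -/
def ThetaVertex (n L : ℕ) : Type :=
  {q : Fin (n + 1) × Fin (L + 1) // q.2.val = 0 ∨ q.2.val = L → q.1 = 0}

namespace ThetaVertex

variable {n L : ℕ}

instance : Finite (ThetaVertex n L) := inferInstanceAs (Finite (Subtype _))

/-- The distance of a vertex from the first hub along its path. -/
def pos (v : ThetaVertex n L) : ℕ := v.1.2.val

/-- The vertex at position `a` of path `i`. -/
def vtx (L : ℕ) (i : Fin (n + 1)) (a : ℕ) : ThetaVertex n L :=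
  ⟨(if 0 < a ∧ a < L then i else 0, ⟨min a L, by omega⟩), by
    intro h
    dsimp only at h
    rw [if_neg (by omega)]⟩

theorem pos_le (v : ThetaVertex n L) : v.pos ≤ L := Nat.lt_succ_iff.1 v.1.2.2

theorem pos_vtx {i : Fin (n + 1)} {a : ℕ} (ha : a ≤ L) : (vtx L i a).pos = a := by
  simp [pos, vtx, ha]

theorem exists_eq_vtx (v : ThetaVertex n L) : ∃ i, v = vtx L i v.pos := by
  refine ⟨v.1.1, Subtype.ext (Prod.ext ?_ (Fin.ext ?_))⟩
  · have h := v.2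
    have h' := v.pos_le
    by_cases h'' : 0 < v.pos ∧ v.pos < L
    · exact (if_pos h'').symm
    · exact (h (show v.pos = 0 ∨ v.pos = L by omega)).trans (if_neg h'').symm
  · have h' := v.pos_le
    simp only [vtx, pos] at h' ⊢
    omega

theorem vtx_inj {i j : Fin (n + 1)} {a b : ℕ} (ha : a ≤ L) (hb : b ≤ L)
    (h : vtx L i a = vtx L j b) : a = b ∧ (0 < a → a < L → i = j) := by
  have hab : a = b := by rw [← pos_vtx (i := i) ha, h, pos_vtx hb]
  subst hab
  refine ⟨rfl, fun h0 h1 => ?_⟩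
  have := congrArg (fun v => v.1.1) h
  simpa [vtx, h0, h1] using this

theorem vtx_zero (i j : Fin (n + 1)) : vtx L i 0 = vtx L j 0 :=
  Subtype.ext (by simp [vtx])

theorem vtx_last (i j : Fin (n + 1)) : vtx L i L = vtx L j L :=
  Subtype.ext (by simp [vtx])

end ThetaVertex

open ThetaVertex

/-- The theta graph with `n + 1` internally disjoint paths of length `L` between two hubs. -/
def thetaGraph (n L : ℕ) : SimpleGraph (ThetaVertex n L) where
  Adj u v := ∃ i a, a < L ∧
    (u = vtx L i a ∧ v = vtx L i (a + 1) ∨ u = vtx L i (a + 1) ∧ v = vtx L i a)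
  symm := ⟨fun _ _ ⟨i, a, ha, h⟩ => ⟨i, a, ha, by tauto⟩⟩
  loopless := ⟨by
    rintro u ⟨i, a, ha, ⟨h, h'⟩ | ⟨h, h'⟩⟩
    · have := (vtx_inj (by omega) (by omega) (h.symm.trans h')).1
      omega
    · have := (vtx_inj (by omega) (by omega) (h.symm.trans h')).1
      omega⟩

namespace thetaGraph

variable {n L : ℕ}

theorem adj_vtx (i : Fin (n + 1)) {a : ℕ} (ha : a < L) :
    (thetaGraph n L).Adj (vtx L i a) (vtx L i (a + 1)) := ⟨i, a, ha, Or.inl ⟨rfl, rfl⟩⟩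

theorem eq_of_adj_vtx {i : Fin (n + 1)} {a : ℕ} {v : ThetaVertex n L} (h0 : 0 < a) (h1 : a < L)
    (h : (thetaGraph n L).Adj (vtx L i a) v) : v = vtx L i (a - 1) ∨ v = vtx L i (a + 1) := by
  obtain ⟨j, b, hb, ⟨h, h'⟩ | ⟨h, h'⟩⟩ := h
  · obtain ⟨rfl, hi⟩ := vtx_inj (by omega) (by omega) h
    rw [hi h0 h1]
    exact Or.inr h'
  · obtain ⟨rfl, hi⟩ := vtx_inj (by omega) (by omega) h
    rw [hi h0 h1]
    exact Or.inl h'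

theorem eq_of_adj_vtx_zero {i : Fin (n + 1)} {v : ThetaVertex n L}
    (h : (thetaGraph n L).Adj (vtx L i 0) v) : ∃ j, v = vtx L j 1 := by
  obtain ⟨j, b, hb, ⟨h, h'⟩ | ⟨h, h'⟩⟩ := h
  · obtain ⟨rfl, -⟩ := vtx_inj (by omega) (by omega) h
    exact ⟨j, h'⟩
  · have := (vtx_inj (by omega) (by omega) h).1
    omega

theorem eq_of_adj_vtx_last {i : Fin (n + 1)} {v : ThetaVertex n L}
    (h : (thetaGraph n L).Adj (vtx L i L) v) : ∃ j, v = vtx L j (L - 1) := by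
  obtain ⟨j, b, hb, ⟨h, h'⟩ | ⟨h, h'⟩⟩ := h
  · have := (vtx_inj (by omega) (by omega) h).1
    omega
  · have := (vtx_inj (by omega) (by omega) h).1
    subst this
    exact ⟨j, h'⟩

/-! ### Connectivity -/

/-- Reachability of two vertices in the graph with the vertices of `S` deleted. -/
def ReachableAvoiding (S : Set (ThetaVertex n L)) (u v : ThetaVertex n L) : Prop :=
  ∃ (hu : u ∈ Sᶜ) (hv : v ∈ Sᶜ), ((thetaGraph n L).induce Sᶜ).Reachable ⟨u, hu⟩ ⟨v, hv⟩

theorem ReachableAvoiding.symm {S : Set (ThetaVertex n L)} {u v : ThetaVertex n L}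
    (h : ReachableAvoiding S u v) : ReachableAvoiding S v u :=
  let ⟨hu, hv, h⟩ := h
  ⟨hv, hu, h.symm⟩

theorem ReachableAvoiding.trans {S : Set (ThetaVertex n L)} {u v w : ThetaVertex n L}
    (h : ReachableAvoiding S u v) (h' : ReachableAvoiding S v w) : ReachableAvoiding S u w :=
  let ⟨hu, _, h⟩ := h
  let ⟨_, hw, h'⟩ := h'
  ⟨hu, hw, h.trans h'⟩

theorem reachableAvoiding_vtx {S : Set (ThetaVertex n L)} (i : Fin (n + 1)) {a b : ℕ} (hab : a ≤ b)
    (hb : b ≤ L) (h : ∀ t, a ≤ t → t ≤ b → vtx L i t ∉ S) :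
    ReachableAvoiding S (vtx L i a) (vtx L i b) := by
  induction b, hab using Nat.le_induction with
  | base => exact ⟨h a le_rfl le_rfl, h a le_rfl le_rfl, Reachable.refl _⟩
  | succ b hab ih =>
    refine (ih (by omega) fun t h1 h2 => h t h1 (by omega)).trans
      ⟨h b hab (by omega), h (b + 1) (by omega) le_rfl, Adj.reachable ?_⟩
    exact adj_vtx i (by omega)

theorem connected_induce_compl (hn : 1 ≤ n) (hL : 1 ≤ L) {S : Set (ThetaVertex n L)}
    (hS : S.Subsingleton) : ((thetaGraph n L).induce Sᶜ).Connected := by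
  suffices h : ∃ r ∉ S, ∀ v ∉ S, ReachableAvoiding S r v by
    obtain ⟨r, hr, h⟩ := h
    have : Nonempty ↥Sᶜ := ⟨⟨r, hr⟩⟩
    refine ⟨fun u v => ?_⟩
    obtain ⟨_, _, h1⟩ := h u u.2
    obtain ⟨_, _, h2⟩ := h v v.2
    exact h1.symm.trans h2
  by_cases h0 : vtx L 0 0 ∈ S
  · have hpos : ∀ i t, 0 < t → t ≤ L → vtx L i t ∉ S := fun i t ht htL h => by
      have := (vtx_inj (by omega) (by omega) (hS h h0)).1
      omega
    refine ⟨vtx L 0 L, hpos _ _ (by omega) le_rfl, fun v hv => ?_⟩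
    obtain ⟨i, hi⟩ := v.exists_eq_vtx
    have hle := v.pos_le
    generalize v.pos = a at hi hle
    subst hi
    have ha : 0 < a := by
      rcases Nat.eq_zero_or_pos a with rfl | h
      · exact absurd (vtx_zero i 0 ▸ h0) hv
      · exact h
    rw [vtx_last 0 i]
    exact (reachableAvoiding_vtx i hle le_rfl fun t h1 h2 => hpos i t (by omega) h2).symm
  · refine ⟨vtx L 0 0, h0, fun v hv => ?_⟩
    obtain ⟨i, hi⟩ := v.exists_eq_vtx
    have hle := v.pos_le
    generalize v.pos = a at hi hle
    subst hi
    by_cases hdown : ∀ t, 0 ≤ t → t ≤ a → vtx L i t ∉ S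
    · rw [vtx_zero 0 i]
      exact reachableAvoiding_vtx i (Nat.zero_le _) hle hdown
    push Not at hdown
    obtain ⟨t, -, hta, htS⟩ := hdown
    have ht0 : 0 < t := by
      rcases Nat.eq_zero_or_pos t with rfl | h
      · exact absurd (vtx_zero i 0 ▸ htS) h0
      · exact h
    have htne : t ≠ a := by
      rintro rfl
      exact hv htS
    have hup : ReachableAvoiding S (vtx L i a) (vtx L i L) :=
      reachableAvoiding_vtx i hle le_rfl fun t' h1 h2 h => by
        have := (vtx_inj (by omega) (by omega) (hS h htS)).1
        omega
    obtain ⟨j, hj⟩ : ∃ j : Fin (n + 1), j ≠ i := by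
      have : Nontrivial (Fin (n + 1)) := Fin.nontrivial_iff_two_le.2 (by omega)
      exact exists_ne i
    have hother : ReachableAvoiding S (vtx L j 0) (vtx L j L) :=
      reachableAvoiding_vtx j (Nat.zero_le _) le_rfl fun t' h1 h2 h => by
        obtain ⟨rfl, hij⟩ := vtx_inj (by omega) (by omega) (hS h htS)
        exact hj (hij ht0 (by omega))
    rw [vtx_zero 0 j]
    rw [vtx_last j i] at hother
    exact hother.trans hup.symm

theorem kConnected_two (hn : 1 ≤ n) (hL : 2 ≤ L) : KConnected 2 (thetaGraph n L) := by
  refine ⟨?_, fun S hS hcard => connected_induce_compl hn (by omega) fun u hu v hv =>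
    (Set.ncard_le_one hS).1 (by omega) u hu v hv⟩
  have hinj : Function.Injective fun a : Fin (L + 1) => vtx (n := n) L 0 a.val := fun a b h =>
    Fin.ext (vtx_inj (by omega) (by omega) h).1
  have := Nat.card_le_card_of_injective _ hinj
  rw [Nat.card_fin] at this
  omega

/-! ### Girth -/

theorem pos_le_pos_add_one {u v : ThetaVertex n L} (h : (thetaGraph n L).Adj u v) :
    v.pos ≤ u.pos + 1 := by
  obtain ⟨j, b, hb, ⟨rfl, rfl⟩ | ⟨rfl, rfl⟩⟩ := h
  · rw [pos_vtx (by omega), pos_vtx (by omega)]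
  · rw [pos_vtx (by omega), pos_vtx (by omega)]
    omega

theorem pos_le_pos_add_length {u v : ThetaVertex n L} (w : (thetaGraph n L).Walk u v) :
    v.pos ≤ u.pos + w.length := by
  induction w with
  | nil => simp
  | cons h w ih =>
    have := pos_le_pos_add_one h
    rw [Walk.length_cons]
    omega

theorem eq_of_adj_of_pos_le {u v w : ThetaVertex n L} (hu : u.pos < L)
    (hv : (thetaGraph n L).Adj u v) (hw : (thetaGraph n L).Adj u w) (hvu : v.pos ≤ u.pos)
    (hwu : w.pos ≤ u.pos) : v = w := by
  obtain ⟨i, hi⟩ := u.exists_eq_vtx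
  generalize u.pos = a at *
  subst hi
  rcases Nat.eq_zero_or_pos a with rfl | h0
  · obtain ⟨j, rfl⟩ := eq_of_adj_vtx_zero hv
    rw [pos_vtx (by omega)] at hvu
    omega
  · rcases eq_of_adj_vtx h0 hu hv with rfl | rfl
    · rcases eq_of_adj_vtx h0 hu hw with rfl | rfl
      · rfl
      · rw [pos_vtx (by omega)] at hwu
        omega
    · rw [pos_vtx (by omega)] at hvu
      omega

theorem eq_of_adj_of_le_pos {u v w : ThetaVertex n L} (hu : 0 < u.pos)
    (hv : (thetaGraph n L).Adj u v) (hw : (thetaGraph n L).Adj u w) (hvu : u.pos ≤ v.pos)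
    (hwu : u.pos ≤ w.pos) : v = w := by
  obtain ⟨i, hi⟩ := u.exists_eq_vtx
  have hle := u.pos_le
  generalize u.pos = a at *
  subst hi
  rcases hle.eq_or_lt with rfl | h1
  · obtain ⟨j, rfl⟩ := eq_of_adj_vtx_last hv
    rw [pos_vtx (by omega)] at hvu
    omega
  · rcases eq_of_adj_vtx hu h1 hv with rfl | rfl
    · rw [pos_vtx (by omega)] at hvu
      omega
    · rcases eq_of_adj_vtx hu h1 hw with rfl | rfl
      · rw [pos_vtx (by omega)] at hwu
        omega
      · rfl

theorem exists_two_adj_of_mem_support {u m : ThetaVertex n L} {w : (thetaGraph n L).Walk u u}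
    (hw : w.IsCycle) (hm : m ∈ w.support) :
    ∃ v ∈ w.support, ∃ v' ∈ w.support, v ≠ v' ∧
      (thetaGraph n L).Adj m v ∧ (thetaGraph n L).Adj m v' := by
  classical
  have hc := hw.rotate hm
  have hsupp : ∀ x ∈ (w.rotate m hm).support, x ∈ w.support := fun x hx =>
    (Walk.mem_support_rotate_iff w m hm).1 hx
  exact ⟨_, hsupp _ (Walk.getVert_mem_support _ _), _, hsupp _ (Walk.getVert_mem_support _ _),
    hc.snd_ne_penultimate, Walk.adj_snd hc.not_nil, (Walk.adj_penultimate hc.not_nil).symm⟩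

theorem le_length_of_isCycle {u : ThetaVertex n L} {w : (thetaGraph n L).Walk u u}
    (hw : w.IsCycle) : L ≤ w.length := by
  classical
  have hne : w.support.toFinset.Nonempty := ⟨u, by simp⟩
  obtain ⟨x, hx, hxmin⟩ := Finset.exists_min_image _ ThetaVertex.pos hne
  obtain ⟨y, hy, hymax⟩ := Finset.exists_max_image _ ThetaVertex.pos hne
  simp only [List.mem_toFinset] at hx hxmin hy hymax
  have hx0 : x.pos = 0 := by
    by_contra h
    obtain ⟨v, hv, v', hv', hvv', ha, ha'⟩ := exists_two_adj_of_mem_support hw hx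
    exact hvv' (eq_of_adj_of_le_pos (by omega) ha ha' (hxmin v hv) (hxmin v' hv'))
  have hyL : y.pos = L := by
    by_contra h
    obtain ⟨v, hv, v', hv', hvv', ha, ha'⟩ := exists_two_adj_of_mem_support hw hy
    have := y.pos_le
    exact hvv' (eq_of_adj_of_pos_le (by omega) ha ha' (hymax v hv) (hymax v' hv'))
  have hy' : y ∈ (w.rotate x hx).support := (Walk.mem_support_rotate_iff w x hx).2 hy
  have h1 := pos_le_pos_add_length ((w.rotate x hx).takeUntil y hy')
  have h2 := (w.rotate x hx).length_takeUntil_le_length hy'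
  have h3 : (w.rotate x hx).length = w.length := Walk.length_rotate _ _ _
  omega

theorem not_isAcyclic (hn : 1 ≤ n) (hL : 2 ≤ L) : ¬ (thetaGraph n L).IsAcyclic := by
  classical
  intro hac
  have hu := (connected_induce_compl (S := {vtx (n := n) L 0 1}) hn (by omega)
    Set.subsingleton_singleton).preconnected
  have h01 : vtx (n := n) L 0 0 ≠ vtx L 0 1 := fun h => by
    have := (vtx_inj (by omega) (by omega) h).1
    omega
  have h12 : vtx (n := n) L 0 1 ≠ vtx L 0 2 := fun h => by
    have := (vtx_inj (by omega) (by omega) h).1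
    omega
  have h02 : vtx (n := n) L 0 0 ≠ vtx L 0 2 := fun h => by
    have := (vtx_inj (by omega) (by omega) h).1
    omega
  obtain ⟨w⟩ := hu ⟨vtx L 0 0, h01⟩ ⟨vtx L 0 2, h12.symm⟩
  let w' := w.map (SimpleGraph.Embedding.induce _).toHom
  let p : (thetaGraph n L).Walk (vtx L 0 0) (vtx L 0 2) :=
    .cons (adj_vtx 0 (by omega)) (.cons (adj_vtx 0 (by omega)) .nil)
  have hp : p.IsPath := by
    simp [p, Walk.isPath_def, h01, h12, h02]
  have heq := (hac.subsingleton_path _ _).elim ⟨p, hp⟩ w'.toPath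
  have hmem : vtx L 0 1 ∈ w'.support := by
    apply Walk.support_toPath_subset_support w'
    rw [← heq]
    simp [p]
  simp only [w', Walk.support_map, List.mem_map] at hmem
  obtain ⟨z, -, hz⟩ := hmem
  exact z.2 hz

theorem le_girth (hn : 1 ≤ n) (hL : 2 ≤ L) : L ≤ (thetaGraph n L).girth := by
  obtain ⟨u, w, hw, h⟩ := exists_girth_eq_length.2 (not_isAcyclic hn hL)
  rw [h]
  exact le_length_of_isCycle hw

/-! ### Colorings -/

variable {c : Sym2 (ThetaVertex n L) → ZMod 3} {f : ℕ → ThetaVertex n L} {ℓ : ℕ}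

/-- The vertices `f 0, …, f ℓ` form a path of the theta graph whose edge colors are
strongly proper. -/
structure IsStronglyProperRoute (c : Sym2 (ThetaVertex n L) → ZMod 3) (f : ℕ → ThetaVertex n L)
    (ℓ : ℕ) : Prop where
  adj : ∀ t < ℓ, (thetaGraph n L).Adj (f t) (f (t + 1))
  inj : ∀ s ≤ ℓ, ∀ t ≤ ℓ, f s = f t → s = t
  color_ne_succ : ∀ t, t + 1 < ℓ → c s(f t, f (t + 1)) ≠ c s(f (t + 1), f (t + 2))
  color_ne_add_two : ∀ t, t + 2 < ℓ → c s(f t, f (t + 1)) ≠ c s(f (t + 2), f (t + 3))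

namespace IsStronglyProperRoute

theorem of_walk {u v : ThetaVertex n L} {p : (thetaGraph n L).Walk u v} (hp : p.IsPath)
    (hc : StronglyProperSeq (p.edges.map c)) : IsStronglyProperRoute c p.getVert p.length := by
  have hne : ∀ s t, s < t → t ≤ s + 2 → t < p.length →
      c s(p.getVert s, p.getVert (s + 1)) ≠ c s(p.getVert t, p.getVert (t + 1)) := by
    intro s t hst hts ht
    have := hc s t hst hts (by simp; omega) (by simpa using ht)
    simpa [Walk.getElem_edges] using this
  exact ⟨fun t ht => p.adj_getVert_succ ht, fun s hs t ht h => hp.getVert_injOn hs ht h,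
    fun t ht => hne t (t + 1) (by omega) (by omega) ht,
    fun t ht => hne t (t + 2) (by omega) le_rfl ht⟩

theorem reverse (h : IsStronglyProperRoute c f ℓ) :
    IsStronglyProperRoute c (fun t => f (ℓ - t)) ℓ where
  adj t ht := by
    have := h.adj (ℓ - (t + 1)) (by omega)
    rw [show ℓ - (t + 1) + 1 = ℓ - t by omega] at this
    exact this.symm
  inj s hs t ht hst := by
    have := h.inj _ (by omega) _ (by omega) hst
    omega
  color_ne_succ t ht := by
    have := h.color_ne_succ (ℓ - (t + 2)) (by omega)
    rw [show ℓ - (t + 2) + 1 = ℓ - (t + 1) by omega,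
      show ℓ - (t + 2) + 2 = ℓ - t by omega] at this
    rw [Sym2.eq_swap, Sym2.eq_swap (a := f (ℓ - (t + 1))) (b := f (ℓ - (t + 2)))]
    exact this.symm
  color_ne_add_two t ht := by
    have := h.color_ne_add_two (ℓ - (t + 3)) (by omega)
    rw [show ℓ - (t + 3) + 1 = ℓ - (t + 2) by omega,
      show ℓ - (t + 3) + 2 = ℓ - (t + 1) by omega,
      show ℓ - (t + 3) + 3 = ℓ - t by omega] at this
    rw [Sym2.eq_swap, Sym2.eq_swap (a := f (ℓ - (t + 2))) (b := f (ℓ - (t + 3)))]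
    exact this.symm

/-- With three colors, the colors along a strongly proper path form an arithmetic progression. -/
theorem exists_color_eq (h : IsStronglyProperRoute c f ℓ) (hl : 2 ≤ ℓ) :
    ∃ ε : ZMod 3, ε ≠ 0 ∧ ∀ t < ℓ, c s(f t, f (t + 1)) = c s(f 0, f 1) + t * ε := by
  have key : ∀ x y z : ZMod 3, x ≠ y → y ≠ z → x ≠ z → z = y + (y - x) := by decide
  refine ⟨c s(f 1, f 2) - c s(f 0, f 1), sub_ne_zero.2 (h.color_ne_succ 0 (by omega)).symm, ?_⟩
  intro t
  induction t using Nat.strong_induction_on with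
  | _ t ih =>
    intro ht
    match t with
    | 0 => simp
    | 1 => simp
    | t + 2 =>
      have e := key _ _ _ (h.color_ne_succ t (by omega)) (h.color_ne_succ (t + 1) (by omega))
        (h.color_ne_add_two t (by omega))
      have e1 := ih (t + 1) (by omega) (by omega)
      rw [ih t (by omega) (by omega), e1] at e
      rw [e]
      push_cast
      ring

/-- A path in the theta graph keeps descending towards the first hub. -/
theorem eq_vtx_sub (hf : IsStronglyProperRoute c f ℓ) {i : Fin (n + 1)} {s a : ℕ} (haL : a ≤ L)
    (h0 : f s = vtx L i a) (h1 : f (s + 1) = vtx L i (a - 1)) {r : ℕ} (hr : r ≤ a)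
    (hrl : s + r ≤ ℓ) : f (s + r) = vtx L i (a - r) := by
  induction r using Nat.strong_induction_on with
  | _ r ih =>
    match r with
    | 0 => exact h0
    | 1 => exact h1
    | r + 2 =>
      have e0 := ih r (by omega) (by omega) (by omega)
      have e1 := ih (r + 1) (by omega) (by omega) (by omega)
      have hA := hf.adj (s + (r + 1)) (by omega)
      rw [e1] at hA
      rcases eq_of_adj_vtx (by omega) (by omega) hA with h | h
      · rw [show s + (r + 2) = s + (r + 1) + 1 by omega, h]
        congr 1
      · rw [show a - (r + 1) + 1 = a - r by omega, ← e0] at h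
        have := hf.inj _ (by omega) _ (by omega) h
        omega

/-- A path in the theta graph keeps ascending towards the second hub. -/
theorem eq_vtx_add (hf : IsStronglyProperRoute c f ℓ) {i : Fin (n + 1)} {s a : ℕ}
    (h0 : f s = vtx L i a) (h1 : f (s + 1) = vtx L i (a + 1)) {r : ℕ} (hr : a + r ≤ L)
    (hrl : s + r ≤ ℓ) : f (s + r) = vtx L i (a + r) := by
  induction r using Nat.strong_induction_on with
  | _ r ih =>
    match r with
    | 0 => exact h0
    | 1 => exact h1
    | r + 2 =>
      have e0 := ih r (by omega) (by omega) (by omega)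
      have e1 := ih (r + 1) (by omega) (by omega) (by omega)
      have hA := hf.adj (s + (r + 1)) (by omega)
      rw [e1] at hA
      rcases eq_of_adj_vtx (by omega) (by omega) hA with h | h
      · rw [show a + (r + 1) - 1 = a + r by omega, ← e0] at h
        have := hf.inj _ (by omega) _ (by omega) h
        omega
      · rw [show s + (r + 2) = s + (r + 1) + 1 by omega, h]
        congr 1

variable {i j : Fin (n + 1)} {a : ℕ}

/-- A path starting downwards from an interior vertex of path `i` and ending on another path
reaches the first hub. -/
theorem le_length_of_descending (hf : IsStronglyProperRoute c f ℓ) (hij : i ≠ j) (ha : 0 < a)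
    (haL : a < L) (h0 : f 0 = vtx L i a) (hl : f ℓ = vtx L j a) (h1 : f 1 = vtx L i (a - 1)) :
    a ≤ ℓ := by
  by_contra hlt
  have h := hf.eq_vtx_sub haL.le h0 h1 (r := ℓ) (by omega) (by omega)
  rw [Nat.zero_add, hl] at h
  exact hij ((vtx_inj (by omega) (by omega) h).2 ha haL).symm

/-- A path starting upwards from an interior vertex of path `i` and ending on another path
reaches the second hub. -/
theorem le_length_of_ascending (hf : IsStronglyProperRoute c f ℓ) (hij : i ≠ j) (ha : 0 < a)
    (haL : a < L) (h0 : f 0 = vtx L i a) (hl : f ℓ = vtx L j a) (h1 : f 1 = vtx L i (a + 1)) :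
    L - a ≤ ℓ := by
  by_contra hlt
  have h := hf.eq_vtx_add h0 h1 (r := ℓ) (by omega) (by omega)
  rw [Nat.zero_add, hl] at h
  exact hij ((vtx_inj (by omega) (by omega) h).2 ha haL).symm

/-- If paths `i` and `j` carry the same colors, no strongly proper path between them passes
through the first hub only. -/
theorem not_through_first_hub (hf : IsStronglyProperRoute c f ℓ) (hij : i ≠ j)
    (hw : ∀ b < L, c s(vtx L i b, vtx L i (b + 1)) = c s(vtx L j b, vtx L j (b + 1)))
    (ha : 0 < a) (haL : a < L) (h0 : f 0 = vtx L i a) (hl : f ℓ = vtx L j a)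
    (h1 : f 1 = vtx L i (a - 1)) (hl1 : f (ℓ - 1) = vtx L j (a - 1)) : False := by
  have hal := hf.le_length_of_descending hij ha haL h0 hl h1
  have hd : ∀ r ≤ a, f r = vtx L i (a - r) := fun r hr => by
    simpa using hf.eq_vtx_sub haL.le h0 h1 hr (by omega)
  have hd' : ∀ r ≤ a, f (ℓ - r) = vtx L j (a - r) := fun r hr => by
    simpa using hf.reverse.eq_vtx_sub (s := 0) haL.le hl hl1 hr (by omega)
  have hmid : a = ℓ - a := by
    refine hf.inj _ hal _ (by omega) ?_
    rw [hd a le_rfl, hd' a le_rfl, Nat.sub_self, vtx_zero i j]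
  obtain ⟨a, rfl⟩ := Nat.exists_eq_succ_of_ne_zero ha.ne'
  have hne := hf.color_ne_succ a (by omega)
  have e := hd' a (by omega)
  rw [show ℓ - a = a + 2 by omega] at e
  rw [hd a (by omega), hd (a + 1) le_rfl, e, Nat.sub_self,
    show a.succ - a = 0 + 1 by omega, Sym2.eq_swap, hw 0 (by omega), vtx_zero i j] at hne
  exact hne rfl

/-- If paths `i` and `j` carry the same colors, no strongly proper path between them passes
through the second hub only. -/
theorem not_through_second_hub (hf : IsStronglyProperRoute c f ℓ) (hij : i ≠ j)
    (hw : ∀ b < L, c s(vtx L i b, vtx L i (b + 1)) = c s(vtx L j b, vtx L j (b + 1)))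
    (ha : 0 < a) (haL : a < L) (h0 : f 0 = vtx L i a) (hl : f ℓ = vtx L j a)
    (h1 : f 1 = vtx L i (a + 1)) (hl1 : f (ℓ - 1) = vtx L j (a + 1)) : False := by
  have hal := hf.le_length_of_ascending hij ha haL h0 hl h1
  have hd : ∀ r ≤ L - a, f r = vtx L i (a + r) := fun r hr => by
    simpa using hf.eq_vtx_add h0 h1 (r := r) (by omega) (by omega)
  have hd' : ∀ r ≤ L - a, f (ℓ - r) = vtx L j (a + r) := fun r hr => by
    simpa using hf.reverse.eq_vtx_add (s := 0) hl hl1 (r := r) (by omega) (by omega)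
  obtain ⟨b, rfl⟩ : ∃ b, L = a + (b + 1) := ⟨L - a - 1, by omega⟩
  have hmid : b + 1 = ℓ - (b + 1) := by
    refine hf.inj _ (by omega) _ (by omega) ?_
    rw [hd _ (by omega), hd' _ (by omega), vtx_last i j]
  have hne := hf.color_ne_succ b (by omega)
  have e := hd' b (by omega)
  rw [show ℓ - b = b + 2 by omega] at e
  rw [hd b (by omega), hd (b + 1) (by omega), e, Sym2.eq_swap (a := vtx _ i (a + (b + 1))),
    vtx_last i j] at hne
  have hwb := hw (a + b) (by omega)
  rw [show a + b + 1 = a + (b + 1) by omega, vtx_last i j] at hwb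
  exact hne hwb

/-- If paths `i` and `j` carry the same colors, a strongly proper path which descends on `i` and
comes back to the same height of `j` through both hubs forces the colors on `i` to rotate in
one direction, except at the starting vertex. -/
theorem exists_color_step_of_descending (hf : IsStronglyProperRoute c f ℓ)
    (hL : (L : ZMod 3) = 1) (hij : i ≠ j)
    (hw : ∀ b < L, c s(vtx L i b, vtx L i (b + 1)) = c s(vtx L j b, vtx L j (b + 1)))
    (ha : 0 < a) (haL : a < L) (h0 : f 0 = vtx L i a) (hl : f ℓ = vtx L j a)
    (h1 : f 1 = vtx L i (a - 1)) (hl1 : f (ℓ - 1) = vtx L j (a + 1)) :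
    ∃ δ : ZMod 3, δ ≠ 0 ∧ ∀ b, b + 1 < L → c s(vtx L i (b + 1), vtx L i (b + 2)) =
      c s(vtx L i b, vtx L i (b + 1)) + if b + 1 = a then -δ else δ := by
  have hal := hf.le_length_of_descending hij ha haL h0 hl h1
  have hal' := hf.reverse.le_length_of_ascending hij.symm ha haL hl (by simpa using h0) hl1
  have hd : ∀ r ≤ a, f r = vtx L i (a - r) := fun r hr => by
    simpa using hf.eq_vtx_sub haL.le h0 h1 hr (by omega)
  have hu : ∀ r ≤ L - a, f (ℓ - r) = vtx L j (a + r) := fun r hr => by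
    simpa using hf.reverse.eq_vtx_add (s := 0) hl hl1 (r := r) (by omega) (by omega)
  have hx : f a = vtx L i 0 := by rw [hd a le_rfl, Nat.sub_self]
  have hy : f (ℓ - (L - a)) = vtx L j L := by
    rw [hu _ le_rfl]
    congr 1
    omega
  have hlt : a < ℓ - (L - a) := by
    by_contra hle
    have h := hd (ℓ - (L - a)) (by omega)
    rw [hy] at h
    have := (vtx_inj (by omega) (by omega) h).1
    omega
  have hA := hf.adj a (by omega)
  rw [hx] at hA
  obtain ⟨k, hk⟩ := eq_of_adj_vtx_zero hA
  have hmid : ∀ r ≤ L, a + r ≤ ℓ → f (a + r) = vtx L k r := fun r hr hrl => by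
    simpa using hf.eq_vtx_add (a := 0) (hx.trans (vtx_zero i k)) hk (r := r) (by omega) hrl
  have hlen : ℓ = 2 * L := by
    rcases le_or_gt (ℓ - (L - a)) (a + L) with h | h
    · have e := hmid (ℓ - (L - a) - a) (by omega) (by omega)
      rw [show a + (ℓ - (L - a) - a) = ℓ - (L - a) by omega, hy] at e
      have := (vtx_inj (by omega) (by omega) e).1
      omega
    · have e := hmid L le_rfl (by omega)
      rw [vtx_last k j, ← hy] at e
      have := hf.inj _ (by omega) _ (by omega) e
      omega
  subst hlen
  obtain ⟨ε, hε, hprog⟩ := hf.exists_color_eq (by omega)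
  generalize c s(f 0, f 1) = z at hprog
  have hlow : ∀ b < a, c s(vtx L i b, vtx L i (b + 1)) = z + (a - 1 - b) * ε := fun b hb => by
    have e := hprog (a - 1 - b) (by omega)
    rw [hd _ (by omega), hd _ (by omega), Sym2.eq_swap, show a - (a - 1 - b + 1) = b by omega,
      show a - (a - 1 - b) = b + 1 by omega, Nat.cast_sub (by omega), Nat.cast_sub (by omega)] at e
    simpa using e
  have hhigh : ∀ b, a ≤ b → b < L → c s(vtx L i b, vtx L i (b + 1)) = z + (1 + a - b) * ε :=
    fun b hab hb => by
      have e := hprog (2 * L - (b + 1 - a)) (by omega)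
      rw [hu _ (by omega), show 2 * L - (b + 1 - a) + 1 = 2 * L - (b - a) by omega,
        hu _ (by omega), Sym2.eq_swap, show a + (b - a) = b by omega,
        show a + (b + 1 - a) = b + 1 by omega, Nat.cast_sub (by omega),
        Nat.cast_sub (by omega)] at e
      rw [hw b hb, e]
      push_cast
      rw [hL]
      ring
  refine ⟨-ε, neg_ne_zero.2 hε, fun b hb => ?_⟩
  rcases lt_trichotomy (b + 1) a with h | h | h
  · rw [if_neg h.ne, hlow b (by omega), hlow (b + 1) h]
    push_cast
    ring
  · rw [if_pos h, hlow b (by omega), hhigh (b + 1) h.ge hb, ← h]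
    push_cast
    ring
  · rw [if_neg h.ne', hhigh b (by omega) (by omega), hhigh (b + 1) h.le hb]
    push_cast
    ring

/-- If paths `i` and `j` carry the same colors, a strongly proper path joining their vertices at
the same height `a` forces the colors on `i` to rotate in one direction, except at `a`. -/
theorem exists_color_step (hf : IsStronglyProperRoute c f ℓ)
    (hL : (L : ZMod 3) = 1) (hij : i ≠ j)
    (hw : ∀ b < L, c s(vtx L i b, vtx L i (b + 1)) = c s(vtx L j b, vtx L j (b + 1)))
    (ha : 0 < a) (haL : a < L) (h0 : f 0 = vtx L i a) (hl : f ℓ = vtx L j a) :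
    ∃ δ : ZMod 3, δ ≠ 0 ∧ ∀ b, b + 1 < L → c s(vtx L i (b + 1), vtx L i (b + 2)) =
      c s(vtx L i b, vtx L i (b + 1)) + if b + 1 = a then -δ else δ := by
  have hpos : 0 < ℓ := by
    rcases Nat.eq_zero_or_pos ℓ with rfl | h
    · exact absurd ((vtx_inj haL.le haL.le (h0.symm.trans hl)).2 ha haL) hij
    · exact h
  have hA := hf.adj 0 hpos
  have hB := hf.reverse.adj 0 hpos
  rw [h0] at hA
  simp only [Nat.sub_zero, hl] at hB
  rcases eq_of_adj_vtx ha haL hA with h1 | h1 <;> rcases eq_of_adj_vtx ha haL hB with hl1 | hl1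
  · exact (hf.not_through_first_hub hij hw ha haL h0 hl h1 hl1).elim
  · exact hf.exists_color_step_of_descending hL hij hw ha haL h0 hl h1 hl1
  · obtain ⟨δ, hδ, h⟩ := hf.reverse.exists_color_step_of_descending hL hij.symm
      (fun b hb => (hw b hb).symm) ha haL hl (by simpa using h0) hl1
      (by simpa [Nat.sub_sub_self hpos] using h1)
    refine ⟨δ, hδ, fun b hb => ?_⟩
    rw [hw (b + 1) hb, hw b (by omega)]
    exact h b hb
  · exact (hf.not_through_second_hub hij hw ha haL h0 hl h1 hl1).elim

end IsStronglyProperRoute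

theorem not_isStronglyProperConnected (hn : 3 ^ L ≤ n) (hL4 : 4 ≤ L) (hL : (L : ZMod 3) = 1)
    (c : Sym2 (ThetaVertex n L) → ZMod 3) :
    ¬ IsStronglyProperConnected (thetaGraph n L) c := by
  intro hc
  obtain ⟨i, j, hij, hw⟩ := Fintype.exists_ne_map_eq_of_card_lt
    (fun (i : Fin (n + 1)) (b : Fin L) => c s(vtx L i b, vtx L i (b + 1))) (by simp; omega)
  have hstep : ∀ a, 0 < a → a < L → ∃ δ : ZMod 3, δ ≠ 0 ∧ ∀ b, b + 1 < L →
      c s(vtx L i (b + 1), vtx L i (b + 2)) =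
        c s(vtx L i b, vtx L i (b + 1)) + if b + 1 = a then -δ else δ := by
    intro a ha haL
    obtain ⟨p, hp, hpc⟩ := hc (vtx L i a) (vtx L j a)
      fun h => hij ((vtx_inj haL.le haL.le h).2 ha haL)
    exact (IsStronglyProperRoute.of_walk hp hpc).exists_color_step hL hij
      (fun b hb => congrFun hw ⟨b, hb⟩) ha haL p.getVert_zero p.getVert_length
  obtain ⟨δ, hδ, h⟩ := hstep 1 (by omega) (by omega)
  obtain ⟨δ', hδ', h'⟩ := hstep 2 (by omega) (by omega)
  have e1 := (h 1 (by omega)).symm.trans (h' 1 (by omega))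
  have e2 := (h 2 (by omega)).symm.trans (h' 2 (by omega))
  simp only [add_right_inj] at e1 e2
  norm_num at e1 e2
  have key : ∀ x y : ZMod 3, y ≠ 0 → x = -y → x = y → False := by decide
  exact key δ δ' hδ' e1 e2

end thetaGraph

/-- For every `d ≥ 3` there is a 2-connected graph of girth at least `d` for which
no edge coloring with 3 colors is strongly proper connected, i.e. `spc(G) ≥ 4`. -/
theorem exists_two_connected_large_girth_spc_ge_four (d : ℕ) (hd : 3 ≤ d) :
    ∃ (V : Type) (G : SimpleGraph V), KConnected 2 G ∧ (d : ℕ∞) ≤ G.girth ∧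
      ¬ ∃ c : Sym2 V → Fin 3, IsStronglyProperConnected G c := by
  have hL : ((3 * d + 1 : ℕ) : ZMod 3) = 1 := by
    push_cast
    rw [show (3 : ZMod 3) = 0 from rfl, zero_mul, zero_add]
  refine ⟨_, thetaGraph (3 ^ (3 * d + 1)) (3 * d + 1),
    thetaGraph.kConnected_two (Nat.one_le_pow _ _ (by omega)) (by omega), ?_, ?_⟩
  · have := thetaGraph.le_girth (n := 3 ^ (3 * d + 1)) (L := 3 * d + 1)
      (Nat.one_le_pow _ _ (by omega)) (by omega)
    exact_mod_cast (by omega : d ≤ 3 * d + 1).trans this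
  · rintro ⟨c, hc⟩
    exact thetaGraph.not_isStronglyProperConnected le_rfl (by omega) hL c hc
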